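/- Let f : ℝⁿ → ℝ be C² and symmetric. Let A be a real diagonal n×n matrix with pairwise distinct diagonal entries λ₁, …, λₙ, and let B be a real symmetric n×n matrix. Define g(s) = f(λ(A + sB)), where λ(M) denotes the eigenvalue vector of the symmetric matrix M. Then g is twice differentiable at s = 0 and g''(0) = Σₖ Σₗ ∂²f/∂λₖ∂λₗ(λ) · Bₖₖ Bₗₗ + 2 Σ_{k<l} ((∂f/∂λₖ(λ) − ∂f/∂λₗ(λ)) / (λₖ − λₗ)) · Bₖₗ². -/

import Mathlib

section

open Filter Topology

variable {ι : Type*} [Fintype ι] [DecidableEq ι]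

theorem Matrix.IsHermitian.exists_perm_eigenvalues_comp_eq {M : Matrix ι ι ℝ} (hM : M.IsHermitian)
    {μ : ι → ℝ} (hμ : Function.Injective μ) {v : ι → ι → ℝ} (hv : ∀ k, v k ≠ 0)
    (hMv : ∀ k, M.mulVec (v k) = μ k • v k) :
    ∃ σ : Equiv.Perm ι, hM.eigenvalues ∘ σ = μ := by
  have hmem (k : ι) : ∃ j, hM.eigenvalues j = μ k := by
    have : μ k ∈ spectrum ℝ M := by
      rw [← Matrix.spectrum_toLin']
      exact (Module.End.hasEigenvalue_of_hasEigenvector (x := v k)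
        ⟨Module.End.mem_eigenspace_iff.2 (by simpa using hMv k), hv k⟩).mem_spectrum
    rwa [hM.spectrum_real_eq_range_eigenvalues] at this
  choose τ hτ using hmem
  have hinj : Function.Injective τ := fun a b hab => hμ (by rw [← hτ a, ← hτ b, hab])
  exact ⟨Equiv.ofBijective τ (Finite.injective_iff_bijective.1 hinj), funext hτ⟩

theorem exists_contDiffAt_eigenvector_diagonal_add_smul {lam : ι → ℝ}
    (hlam : Function.Injective lam) (B : Matrix ι ι ℝ) (k : ι) :
    ∃ w : ℝ → ι → ℝ, ContDiffAt ℝ 2 w 0 ∧ w 0 = Pi.single k 1 ∧ ∀ᶠ s in 𝓝 0, w s k = 1 ∧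
      (Matrix.diagonal lam + s • B).mulVec (w s) =
        (lam k + s * B.mulVec (w s) k) • w s := by
  set d : ι → ℝ := fun l => if l = k then 1 else lam l - lam k with hd
  have hd0 (l : ι) : d l ≠ 0 := by
    by_cases h : l = k
    · simp [hd, h]
    · simpa [hd, h, sub_eq_zero] using hlam.ne h
  let F : ℝ × (ι → ℝ) → ι → ℝ := fun p l => d l * p.2 l - (if l = k then 1 else 0) +
    p.1 * (if l = k then 0 else B.mulVec p.2 l - B.mulVec p.2 k * p.2 l)
  have hF : ContDiff ℝ 2 F := by
    refine contDiff_pi.2 fun l => ?_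
    by_cases h : l = k <;> simp only [F, h, if_true, if_false, Matrix.mulVec, dotProduct] <;>
      fun_prop
  set u : ℝ × (ι → ℝ) := (0, Pi.single k 1) with hu
  let e : (ι → ℝ) ≃L[ℝ] (ι → ℝ) := ContinuousLinearEquiv.piCongrRight fun l =>
    ContinuousLinearEquiv.unitsEquivAut ℝ (Units.mk0 (d l) (hd0 l))
  have hFu : F u = 0 := by
    ext l
    by_cases h : l = k <;> simp [F, u, hd, h]
  have hinv : (fderiv ℝ F u ∘L .inr ℝ ℝ (ι → ℝ)).IsInvertible := by
    refine ⟨e, ?_⟩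
    have h1 : HasFDerivAt (fun w : ι → ℝ => F (0, w)) (fderiv ℝ F u ∘L .inr ℝ ℝ (ι → ℝ))
        (Pi.single k 1) :=
      ((hF.differentiable (by norm_num)) u).hasFDerivAt.comp _ (hasFDerivAt_prodMk_right _ _)
    have h2 : HasFDerivAt (fun w : ι → ℝ => F (0, w)) (e : (ι → ℝ) →L[ℝ] (ι → ℝ))
        (Pi.single k 1) := by
      have : (fun w : ι → ℝ => F (0, w)) = fun w => e w - fun l => if l = k then 1 else 0 := by
        ext w l
        simp [F, e, mul_comm]
      rw [this]
      exact e.hasFDerivAt.sub_const _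
    exact h2.unique h1
  have hFat : ContDiffAt ℝ 2 F u := hF.contDiffAt
  have h2 : (2 : WithTop ℕ∞) ≠ 0 := by norm_num
  refine ⟨hFat.implicitFunction h2 hinv, hFat.contDiffAt_implicitFunction h2 hinv,
    hFat.implicitFunction_apply_self h2 hinv, ?_⟩
  filter_upwards [hFat.eventually_apply_implicitFunction h2 hinv] with s hs
  set w := hFat.implicitFunction h2 hinv s
  rw [hFu] at hs
  have hk : w k = 1 := by
    have := congrFun hs k
    simp [F, hd] at this
    linarith
  refine ⟨hk, ?_⟩
  ext l
  simp only [Matrix.add_mulVec, Matrix.smul_mulVec, Pi.add_apply, Matrix.mulVec_diagonal,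
    Pi.smul_apply, smul_eq_mul]
  by_cases h : l = k
  · subst h; rw [hk]; ring
  · have := congrFun hs l
    simp [F, hd, h] at this
    linarith

theorem exists_eigenvalue_branch_diagonal_add_smul {lam : ι → ℝ}
    (hlam : Function.Injective lam) {B : Matrix ι ι ℝ} (hB : B.IsHermitian) (k : ι) :
    ∃ (μ μ' : ℝ → ℝ) (w : ℝ → ι → ℝ), μ 0 = lam k ∧ μ' 0 = B k k ∧
      (∀ᶠ s in 𝓝 0, HasDerivAt μ (μ' s) s) ∧
      HasDerivAt μ' (2 * ∑ l, B k l ^ 2 / (lam k - lam l)) 0 ∧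
      ∀ᶠ s in 𝓝 0, w s ≠ 0 ∧ (Matrix.diagonal lam + s • B).mulVec (w s) = μ s • w s := by
  obtain ⟨w, hw, hw0, hev⟩ := exists_contDiffAt_eigenvector_diagonal_add_smul hlam B k
  have hd : ∀ᶠ s in 𝓝 (0 : ℝ), HasDerivAt w (deriv w s) s := by
    filter_upwards [hw.eventually (by simp)] with s hs
    exact (hs.differentiableAt (by norm_num)).hasDerivAt
  have hw' : DifferentiableAt ℝ (deriv w) 0 := by
    have : ContDiffAt ℝ 1 (deriv w) 0 := hw.derivWithin (by norm_num)
    exact this.differentiableAt (by norm_num)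
  have hBw (j : ι) {v : ℝ → ι → ℝ} {v' : ι → ℝ} {s : ℝ} (h : HasDerivAt v v' s) :
      HasDerivAt (fun s => B.mulVec (v s) j) (B.mulVec v' j) s := by
    simp only [Matrix.mulVec, dotProduct]
    exact HasDerivAt.fun_sum fun l _ => ((hasDerivAt_pi.1 h l).const_mul _)
  have hdiff : ∀ l, deriv w 0 l = B k l / (lam k - lam l) := by
    intro l
    have hwl (j : ι) : HasDerivAt (fun s => w s j) (deriv w 0 j) 0 :=
      hasDerivAt_pi.1 hd.self_of_nhds j
    have hBl (j : ι) : HasDerivAt (fun s => s * B.mulVec (w s) j) (B j k) 0 := by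
      simpa [hw0] using (hasDerivAt_id' (0 : ℝ)).fun_mul (hBw j hd.self_of_nhds)
    by_cases h : l = k
    · subst h
      have : HasDerivAt (fun s => w s l) 0 0 :=
        (hasDerivAt_const (0 : ℝ) (1 : ℝ)).congr_of_eventuallyEq (hev.mono fun s hs => hs.1)
      simp [(hwl l).unique this]
    · have h1 : HasDerivAt (fun s => lam l * w s l + s * B.mulVec (w s) l)
          (lam l * deriv w 0 l + B l k) 0 := ((hwl l).const_mul _).add (hBl l)
      have h2 : HasDerivAt (fun s => (lam k + s * B.mulVec (w s) k) * w s l)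
          (lam k * deriv w 0 l) 0 := by
        simpa [hw0, h] using ((hBl k).const_add (lam k)).fun_mul (hwl l)
      have h3 := h1.unique (h2.congr_of_eventuallyEq (hev.mono fun s hs => by
        simpa [Matrix.add_mulVec, Matrix.smul_mulVec, Matrix.mulVec_diagonal]
          using congrFun hs.2 l))
      have hsymm : B l k = B k l := by simpa using hB.apply k l
      have hne : lam k - lam l ≠ 0 := sub_ne_zero.2 (hlam.ne (Ne.symm h))
      rw [eq_div_iff hne, ← hsymm]
      linarith
  refine ⟨fun s => lam k + s * B.mulVec (w s) k,
    fun s => B.mulVec (w s) k + s * B.mulVec (deriv w s) k, w, by simp, by simp [hw0], ?_, ?_, ?_⟩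
  · filter_upwards [hd] with s hs
    simpa using ((hasDerivAt_id s).mul (hBw k hs)).const_add (lam k)
  · have hsum : 2 * ∑ l, B k l ^ 2 / (lam k - lam l) =
        B.mulVec (deriv w 0) k + (1 * B.mulVec (deriv w 0) k +
          0 * B.mulVec (deriv (deriv w) 0) k) := by
      simp only [Matrix.mulVec, dotProduct, hdiff, one_mul, zero_mul, add_zero, ← two_mul]
      exact congrArg _ (Finset.sum_congr rfl fun l _ => by ring)
    rw [hsum]
    exact (hBw k hd.self_of_nhds).add ((hasDerivAt_id (0 : ℝ)).mul (hBw k hw'.hasDerivAt))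
  · filter_upwards [hev] with s hs
    refine ⟨fun h => ?_, hs.2⟩
    simpa [h] using hs.1

theorem hasDerivAt_deriv_comp {E : Type*} [NormedAddCommGroup E] [NormedSpace ℝ E] {f : E → ℝ}
    (hf : ContDiff ℝ 2 f) {g : ℝ → ℝ} {μ μ' : ℝ → E} {μ'' : E} {t : ℝ}
    (hg : ∀ᶠ s in 𝓝 t, g s = f (μ s)) (hμ : ∀ᶠ s in 𝓝 t, HasDerivAt μ (μ' s) s)
    (hμ' : HasDerivAt μ' μ'' t) :
    DifferentiableAt ℝ g t ∧ HasDerivAt (deriv g)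
      (fderiv ℝ (fderiv ℝ f) (μ t) (μ' t) (μ' t) + fderiv ℝ f (μ t) μ'') t := by
  have hg' : ∀ᶠ s in 𝓝 t, HasDerivAt g (fderiv ℝ f (μ s) (μ' s)) s := by
    filter_upwards [hg.eventually_nhds, hμ] with s hs hμs
    exact (((hf.differentiable (by norm_num)) (μ s)).hasFDerivAt.comp_hasDerivAt s
      hμs).congr_of_eventuallyEq hs
  refine ⟨hg'.self_of_nhds.differentiableAt, ?_⟩
  have hf' : Differentiable ℝ (fderiv ℝ f) :=
    (hf.fderiv_right (m := 1) (by norm_num)).differentiable (by norm_num)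
  exact (((hf' (μ t)).hasFDerivAt.comp_hasDerivAt t hμ.self_of_nhds).clm_apply
    hμ').congr_of_eventuallyEq (hg'.mono fun s hs => hs.deriv)

theorem sum_mul_div_sub_eq_sum_lt {ι R : Type*} [Fintype ι] [LinearOrder ι] [Field R]
    (a lam : ι → R) {b : ι → ι → R} (hb : ∀ k l, b k l = b l k) :
    ∑ k, a k * ∑ l, b k l / (lam k - lam l) =
      ∑ k, ∑ l ∈ Finset.univ.filter (fun l => k < l),
        ((a k - a l) / (lam k - lam l)) * b k l := by
  have hsplit (k : ι) : a k * ∑ l, b k l / (lam k - lam l) =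
      (∑ l, if k < l then a k * (b k l / (lam k - lam l)) else 0) +
      ∑ l, if l < k then a k * (b k l / (lam k - lam l)) else 0 := by
    rw [Finset.mul_sum, ← Finset.sum_add_distrib]
    refine Finset.sum_congr rfl fun l _ => ?_
    rcases lt_trichotomy k l with h | h | h
    · simp [h, h.not_gt]
    · simp [h]
    · simp [h, h.not_gt]
  simp only [hsplit, Finset.sum_add_distrib, Finset.sum_filter]
  rw [Finset.sum_comm (f := fun k l => if l < k then a k * (b k l / (lam k - lam l)) else 0),
    ← Finset.sum_add_distrib]
  refine Finset.sum_congr rfl fun k _ => ?_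
  rw [← Finset.sum_add_distrib]
  refine Finset.sum_congr rfl fun l _ => ?_
  split_ifs with h
  · rw [hb l k, ← neg_sub (lam k) (lam l), div_neg]
    ring
  · simp

theorem ContinuousLinearMap.apply_eq_sum_smul_single {F : Type*} [NormedAddCommGroup F]
    [NormedSpace ℝ F] (φ : (ι → ℝ) →L[ℝ] F) (v : ι → ℝ) :
    φ v = ∑ k, v k • φ (Pi.single k 1) := by
  conv_lhs => rw [pi_eq_sum_univ' v]
  rw [map_sum]
  refine Finset.sum_congr rfl fun k _ => ?_
  rw [map_smul]


end

/-- Proposition 2.1: second derivative of the spectral function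
`g(s) = f(λ(A + sB))` at `s = 0`, where `A` is diagonal with pairwise distinct diagonal
entries `λ₁, …, λₙ` and `B` is symmetric. -/
theorem second_derivative_spectral_function (n : ℕ) (f : (Fin n → ℝ) → ℝ)
    (hf : ContDiff ℝ 2 f)
    (hsym : ∀ (σ : Equiv.Perm (Fin n)) (x : Fin n → ℝ), f (x ∘ σ) = f x)
    (lam : Fin n → ℝ) (hlam : Function.Injective lam)
    (B : Matrix (Fin n) (Fin n) ℝ) (hB : B.IsHermitian)
    (g : ℝ → ℝ)
    (hg : ∀ (s : ℝ) (h : (Matrix.diagonal lam + s • B).IsHermitian),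
      g s = f h.eigenvalues) :
    DifferentiableAt ℝ g 0 ∧ DifferentiableAt ℝ (deriv g) 0 ∧
    deriv (deriv g) 0 =
      (∑ k, ∑ l, fderiv ℝ (fun y => fderiv ℝ f y (Pi.single l 1)) lam (Pi.single k 1)
          * B k k * B l l)
      + 2 * ∑ k, ∑ l ∈ Finset.univ.filter (fun l => k < l),
          ((fderiv ℝ f lam (Pi.single k 1) - fderiv ℝ f lam (Pi.single l 1))
            / (lam k - lam l)) * (B k l) ^ 2 := by
  have hbranch (k : Fin n) := exists_eigenvalue_branch_diagonal_add_smul hlam hB k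
  choose μ μ' w hμ0 hμ'0 hμ hμ' hw using hbranch
  have hμ0' : (fun k => μ k 0) = lam := funext hμ0
  have hdμ : ∀ᶠ s in nhds 0, HasDerivAt (fun s k => μ k s) (fun k => μ' k s) s := by
    filter_upwards [Filter.eventually_all.2 hμ] with s hs
    exact hasDerivAt_pi.2 hs
  have hinj : ∀ᶠ s in nhds 0, Function.Injective fun k => μ k s := by
    have hne (k l : Fin n) : ∀ᶠ s in nhds 0, k ≠ l → μ k s ≠ μ l s := by
      by_cases h : k = l
      · simp [h]
      · have hkl : μ k 0 ≠ μ l 0 := by simpa [hμ0] using hlam.ne h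
        filter_upwards [((hμ k).self_of_nhds.continuousAt.sub
          (hμ l).self_of_nhds.continuousAt).eventually_ne (sub_ne_zero.2 hkl)] with s hs _ using sub_ne_zero.1 hs
    filter_upwards [Filter.eventually_all.2 fun k => Filter.eventually_all.2 (hne k)] with s hs k l hkl
    exact not_imp_not.1 (hs k l) hkl
  have hgμ : ∀ᶠ s in nhds 0, g s = f fun k => μ k s := by
    filter_upwards [hinj, Filter.eventually_all.2 hw] with s hs hws
    have hM : (Matrix.diagonal lam + s • B).IsHermitian := by
      refine (Matrix.isHermitian_diagonal lam).add ?_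
      rw [Matrix.IsHermitian, Matrix.conjTranspose_smul, star_trivial, hB.eq]
    obtain ⟨σ, hσ⟩ := hM.exists_perm_eigenvalues_comp_eq hs (fun k => (hws k).1)
      fun k => (hws k).2
    rw [hg s hM, ← hsym σ, hσ]
  obtain ⟨hdiff, hderiv⟩ := hasDerivAt_deriv_comp hf hgμ hdμ (hasDerivAt_pi.2 hμ')
  refine ⟨hdiff, hderiv.differentiableAt, ?_⟩
  rw [hderiv.deriv, hμ0']
  have hf' : Differentiable ℝ (fderiv ℝ f) :=
    (hf.fderiv_right (m := 1) (by norm_num)).differentiable (by norm_num)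
  have hpartial (k l : Fin n) :
      fderiv ℝ (fun y => fderiv ℝ f y (Pi.single l 1)) lam (Pi.single k 1) =
        fderiv ℝ (fderiv ℝ f) lam (Pi.single k 1) (Pi.single l 1) := by
    rw [fderiv_clm_apply (hf' lam) (by fun_prop)]
    simp
  congr 1
  · rw [(fderiv ℝ (fderiv ℝ f) lam).apply_eq_sum_smul_single, sum_apply]
    refine Finset.sum_congr rfl fun k _ => ?_
    rw [smul_apply, ContinuousLinearMap.apply_eq_sum_smul_single,
      Finset.smul_sum]
    refine Finset.sum_congr rfl fun l _ => ?_
    rw [hpartial, hμ'0, hμ'0, smul_eq_mul, smul_eq_mul]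
    ring
  · rw [← sum_mul_div_sub_eq_sum_lt (fun k => fderiv ℝ f lam (Pi.single k 1)) lam
      (b := fun k l => B k l ^ 2) fun k l => by rw [← hB.apply k l, star_trivial],
      ContinuousLinearMap.apply_eq_sum_smul_single, Finset.mul_sum]
    refine Finset.sum_congr rfl fun k _ => ?_
    rw [smul_eq_mul]
    ring
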